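/- There exists a constant C > 0 such that the following holds: for every connected simple graph H on n ≥ 2 vertices, every α ≥ 0, every Nash equilibrium σ of the max-distance network creation game on H such that G(σ) is a spanning tree of H, and every strategy profile τ with G(τ) connected, one has SC(σ) ≤ C·(1 + min{α, ρ_H})·SC(τ). (That is, every tree Nash equilibrium has social cost within a factor min{O(1 + α), O(ρ_H)} of the optimum.) -/

import Mathlib

open scoped ENNReal Classical

namespace NCG

variable {V : Type*}

/-- A strategy profile is valid w.r.t. host graph `H` if each player only buys
edges of `H` incident to it. -/
def Valid (H : SimpleGraph V) (σ : V → Finset V) : Prop :=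
  ∀ v, ∀ w ∈ σ v, H.Adj v w

/-- The graph created by a strategy profile: `u` and `v` are adjacent iff one
of them bought the edge towards the other. -/
def created (σ : V → Finset V) : SimpleGraph V :=
  SimpleGraph.fromRel (fun u v => v ∈ σ u)

/-- Eccentricity of a vertex (`⊤` if the graph is disconnected). -/
noncomputable def ecc (G : SimpleGraph V) (v : V) : ℕ∞ :=
  ⨆ u, G.edist v u

/-- Radius of a graph. -/
noncomputable def radius (G : SimpleGraph V) : ℕ∞ :=
  ⨅ v, ecc G v

/-- The cost of player `v` under strategy profile `σ`, with edge price `α`: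
`α` times the number of bought edges plus the eccentricity of `v` in the
created graph. -/
noncomputable def cost (α : ℝ) (σ : V → Finset V) (v : V) : ℝ≥0∞ :=
  ENNReal.ofReal α * (σ v).card + (ecc (created σ) v : ℝ≥0∞)

/-- Nash equilibrium: no player can strictly decrease its own cost by
unilaterally switching to another valid strategy. -/
def IsNE [DecidableEq V] (H : SimpleGraph V) (α : ℝ) (σ : V → Finset V) : Prop :=
  Valid H σ ∧ ∀ v (s : Finset V), (∀ w ∈ s, H.Adj v w) →
    cost α σ v ≤ cost α (Function.update σ v s) v

/-- Social cost of a strategy profile. -/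
noncomputable def SC [Fintype V] (α : ℝ) (σ : V → Finset V) : ℝ≥0∞ :=
  ∑ v, cost α σ v

end NCG

namespace SimpleGraph

variable {V : Type*} {G : SimpleGraph V}

lemma Walk.dist_add_dist_of_mem_support {u v x : V} (p : G.Walk u v)
    (hp : p.length = G.dist u v) (hx : x ∈ p.support) :
    G.dist u x + G.dist x v ≤ G.dist u v := by
  obtain ⟨q, r, rfl⟩ := p.mem_support_iff_exists_append.1 hx
  rw [Walk.length_append] at hp
  have := G.dist_le q
  have := G.dist_le r
  omega

/-- Removing an edge of a tree separates the vertices closer to one endpoint from those closer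
to the other, so distances across the edge are additive. -/
lemma IsTree.dist_eq_add_of_adj (hG : G.IsTree) {c c' u w : V} (h : G.Adj c c')
    (hw : G.dist w c' = G.dist w c + 1) (hu : G.dist u c = G.dist u c' + 1) :
    G.dist u w = G.dist u c + G.dist c w := by
  have hc := hG.connected
  obtain ⟨p, hp, hpl⟩ := hc.exists_path_of_dist w c
  obtain ⟨q, hq, hql⟩ := hc.exists_path_of_dist c' u
  have hpath : (p.append (Walk.cons h q)).IsPath := by
    rw [Walk.isPath_def, Walk.support_append, List.nodup_append']
    refine ⟨hp.support_nodup, by simpa using hq.support_nodup, ?_⟩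
    intro x hxp hxq
    have hxq : x ∈ q.support := by simpa using hxq
    have h1 := p.dist_add_dist_of_mem_support hpl hxp
    have h2 := q.dist_add_dist_of_mem_support hql hxq
    have h3 := hc.dist_triangle (u := w) (v := x) (w := c')
    have h4 := hc.dist_triangle (u := c) (v := x) (w := u)
    have := G.dist_comm (u := c) (v := u)
    have := G.dist_comm (u := c) (v := x)
    have := G.dist_comm (u := c') (v := u)
    have := G.dist_comm (u := c') (v := x)
    omega
  obtain ⟨r, hr, hrl⟩ := hc.exists_path_of_dist w u
  have heq : p.append (Walk.cons h q) = r :=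
    congrArg Subtype.val ((hG.isAcyclic.subsingleton_path w u).elim ⟨_, hpath⟩ ⟨r, hr⟩)
  rw [← heq, Walk.length_append, Walk.length_cons, hpl, hql] at hrl
  rw [G.dist_comm (u := u) (v := w), ← hrl, hu, G.dist_comm (u := c) (v := w),
    G.dist_comm (u := c') (v := u)]
  omega

/-- A function that decreases by at most `K` along every edge decreases by at most
`K * p.length` along a walk `p`. -/
lemma Walk.le_mul_length_add {f : V → ℝ} {K : ℝ} (hf : ∀ u v, G.Adj u v → f u ≤ K + f v)
    {u v : V} (p : G.Walk u v) : f u ≤ K * p.length + f v := by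
  induction p with
  | nil => simp
  | cons h p ih =>
    have := hf _ _ h
    rw [Walk.length_cons]
    push_cast
    linarith

end SimpleGraph

namespace NCG

variable {V : Type*}

lemma exists_ecc_eq [Finite V] {G : SimpleGraph V} (hG : G.Connected) (v : V) :
    ∃ e : ℕ, ecc G v = e ∧ (∀ u, G.dist v u ≤ e) ∧ ∃ u, G.dist v u = e := by
  have : Nonempty V := ⟨v⟩
  obtain ⟨u, hu⟩ := exists_eq_ciSup_of_finite (f := fun u => G.edist v u)
  have hu' : ecc G v = (G.dist v u : ℕ∞) := by
    rw [(hG v u).coe_dist_eq_edist]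
    exact hu.symm
  refine ⟨_, hu', fun w => ?_, u, rfl⟩
  have : G.edist v w ≤ ecc G v := le_iSup (fun u => G.edist v u) w
  rw [hu', ← (hG v w).coe_dist_eq_edist] at this
  exact_mod_cast this

lemma ecc_le_of_dist_le {G : SimpleGraph V} (hG : G.Connected) {v : V} {e : ℕ}
    (h : ∀ u, G.dist v u ≤ e) : ecc G v ≤ e :=
  iSup_le fun u => by
    rw [← (hG v u).coe_dist_eq_edist]
    exact_mod_cast h u

/-- A tree has a vertex `c` of eccentricity `r` such that every vertex `u` has eccentricity at
least `d(u, c) + r - 1`. -/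
lemma exists_center [Finite V] {G : SimpleGraph V} (hG : G.IsTree) :
    ∃ (c : V) (r : ℕ), (∀ u, G.dist c u ≤ r) ∧ (∃ u, G.dist c u = r) ∧
      ∀ u, ∃ w, G.dist u c + r ≤ G.dist u w + 1 := by
  have hc := hG.connected
  have : Nonempty V := hc.nonempty
  obtain ⟨c, hmin⟩ := Finite.exists_min (fun v => ecc G v)
  obtain ⟨r, hr, hle, hex⟩ := exists_ecc_eq hc c
  refine ⟨c, r, hle, hex, fun u => ?_⟩
  by_cases huc : u = c
  · subst huc
    obtain ⟨w, hw⟩ := hex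
    exact ⟨w, by simp; omega⟩
  obtain ⟨p, -, hpl⟩ := hc.exists_path_of_dist c u
  cases p with
  | nil => exact absurd rfl huc
  | @cons _ c' _ h q =>
    obtain ⟨r', hr', -, w, hw⟩ := exists_ecc_eq hc c'
    have hrr : r ≤ r' := by
      have := hmin c'
      simp only [hr, hr'] at this
      exact_mod_cast this
    have hcw := hle w
    rw [SimpleGraph.dist_comm] at hw hcw
    have hu : G.dist u c = G.dist u c' + 1 := by
      rw [SimpleGraph.Walk.length_cons] at hpl
      have := G.dist_le q
      have := hc.dist_triangle (u := c) (v := c') (w := u)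
      have := SimpleGraph.dist_eq_one_iff_adj.2 h
      rw [G.dist_comm (u := u) (v := c), G.dist_comm (u := u) (v := c')]
      omega
    rcases hG.dist_eq_dist_add_one_of_adj w h with h1 | h1
    · omega
    · refine ⟨w, ?_⟩
      rw [hG.dist_eq_add_of_adj h h1 hu, G.dist_comm (u := c)]
      omega

lemma created_adj {σ : V → Finset V} {u v : V} :
    (created σ).Adj u v ↔ u ≠ v ∧ (v ∈ σ u ∨ u ∈ σ v) :=
  SimpleGraph.fromRel_adj _ _ _

lemma created_mono {σ τ : V → Finset V} (h : ∀ v, σ v ⊆ τ v) : created σ ≤ created τ := by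
  intro u v huv
  rw [created_adj] at huv ⊢
  exact ⟨huv.1, huv.2.imp (h u ·) (h v ·)⟩

lemma Valid.created_le {H : SimpleGraph V} {σ : V → Finset V} (h : Valid H σ) :
    created σ ≤ H := by
  intro u v huv
  rw [created_adj] at huv
  exact huv.2.elim (h u v) fun h' => (h v u h').symm

/-- In a tree equilibrium, every edge of the host graph changes the distance to the center `c`
by at most `α + 2`. -/
lemma IsNE.dist_le_add_dist [Fintype V] [DecidableEq V] {H : SimpleGraph V} {α : ℝ} (hα : 0 ≤ α)
    {σ : V → Finset V} (hσ : IsNE H α σ) (hT : (created σ).Connected) {c : V} {r : ℕ}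
    (hle : ∀ u, (created σ).dist c u ≤ r)
    (hfar : ∀ u, ∃ w, (created σ).dist u c + r ≤ (created σ).dist u w + 1)
    {u v : V} (huv : H.Adj u v) :
    ((created σ).dist u c : ℝ) ≤ (α + 2) + (created σ).dist v c := by
  set T := created σ with hTdef
  set σ' := Function.update σ u (insert v (σ u)) with hσ'
  have hTT' : T ≤ created σ' := by
    refine created_mono fun x => ?_
    by_cases hx : x = u
    · subst hx
      simp [hσ']
    · simp [hσ', hx]
  have hT' : (created σ').Connected := hT.mono hTT'
  have hadj : (created σ').Adj u v := by
    rw [created_adj]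
    exact ⟨huv.ne, Or.inl (by simp [hσ'])⟩
  have hecc : ecc (created σ') u ≤ ((1 + T.dist v c + r : ℕ) : ℕ∞) := by
    refine ecc_le_of_dist_le hT' fun w => ?_
    have h1 := hT'.dist_triangle (u := u) (v := v) (w := w)
    have h2 := SimpleGraph.dist_eq_one_iff_adj.2 hadj
    have h3 := SimpleGraph.Reachable.dist_anti hTT' (hT v w)
    have h4 := hT.dist_triangle (u := v) (v := c) (w := w)
    have h5 := hle w
    omega
  obtain ⟨e, he, hed, -⟩ := exists_ecc_eq hT u
  obtain ⟨w, hw⟩ := hfar u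
  have hwe := hed w
  have hne := hσ.2 u (insert v (σ u)) (by
    intro x hx
    rcases Finset.mem_insert.1 hx with rfl | hx
    · exact huv
    · exact hσ.1 u x hx)
  have hcard : (insert v (σ u)).card ≤ (σ u).card + 1 := Finset.card_insert_le _ _
  have key : ENNReal.ofReal (α * (σ u).card + e) ≤
      ENNReal.ofReal (α * ((σ u).card + 1 : ℕ) + (1 + T.dist v c + r : ℕ)) := by
    calc ENNReal.ofReal (α * (σ u).card + e) = cost α σ u := by
          rw [cost, ← hTdef, he, ENNReal.ofReal_add (by positivity) (by positivity),
            ENNReal.ofReal_mul hα]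
          simp
      _ ≤ cost α σ' u := hne
      _ ≤ ENNReal.ofReal α * ((σ u).card + 1 : ℕ) +
          (((1 + T.dist v c + r : ℕ) : ℕ∞) : ℝ≥0∞) := by
          rw [cost]
          gcongr
          simpa [hσ'] using hcard
      _ = _ := by
          rw [ENNReal.ofReal_add (by positivity) (by positivity), ENNReal.ofReal_mul hα,
            ENNReal.ofReal_natCast, ENNReal.ofReal_natCast, ENat.toENNReal_coe]
  rw [ENNReal.ofReal_le_ofReal_iff (by positivity)] at key
  push_cast at key
  have : (T.dist u c : ℝ) + r ≤ e + 1 := by exact_mod_cast (by omega)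
  linarith

lemma exists_radius_eq [Finite V] {H : SimpleGraph V} (hH : H.Connected) :
    ∃ ρ : ℕ, radius H = ρ ∧ ∀ u v, H.dist u v ≤ 2 * ρ := by
  have : Nonempty V := hH.nonempty
  obtain ⟨z, hz⟩ := exists_eq_ciInf_of_finite (f := fun v => ecc H v)
  obtain ⟨ρ, hρ, hle, -⟩ := exists_ecc_eq hH z
  refine ⟨ρ, by rw [← hρ]; exact hz.symm, fun u v => ?_⟩
  have h1 := hH.dist_triangle (u := u) (v := z) (w := v)
  have h2 := hle u
  have h3 := hle v
  rw [H.dist_comm (u := u) (v := z)] at h1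
  omega

/-- Tree equilibria have diameter `O((1 + α) * ρ)`, where `ρ` is the radius of the host graph. -/
lemma IsNE.ecc_le_of_isTree [Fintype V] [DecidableEq V] {H : SimpleGraph V} {α : ℝ} (hα : 0 ≤ α)
    {σ : V → Finset V} (hσ : IsNE H α σ) (hT : (created σ).IsTree) (hH : H.Connected) {ρ : ℕ}
    (hρ : ∀ u v, H.dist u v ≤ 2 * ρ) (v : V) :
    (ecc (created σ) v : ℝ≥0∞) ≤ ENNReal.ofReal (4 * (α + 2) * ρ) := by
  obtain ⟨c, r, hle, ⟨x, hx⟩, hfar⟩ := exists_center hT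
  have hc := hT.connected
  obtain ⟨p, hp⟩ := hH.exists_walk_length_eq_dist x c
  have h1 := p.le_mul_length_add (f := fun u => ((created σ).dist u c : ℝ)) (K := α + 2)
    fun a b hab => hσ.dist_le_add_dist hα hc hle hfar hab
  have h2 : (p.length : ℝ) ≤ 2 * ρ := by
    rw [hp]
    exact_mod_cast hρ x c
  have h3 : (α + 2) * (p.length : ℝ) ≤ (α + 2) * (2 * ρ) := by gcongr
  simp only [SimpleGraph.dist_self, Nat.cast_zero, add_zero, SimpleGraph.dist_comm (u := x), hx]
    at h1
  have h4 : ecc (created σ) v ≤ ((2 * r : ℕ) : ℕ∞) := by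
    refine ecc_le_of_dist_le hc fun w => ?_
    have := hc.dist_triangle (u := v) (v := c) (w := w)
    have := hle v
    have := hle w
    have := (created σ).dist_comm (u := v) (v := c)
    omega
  calc (ecc (created σ) v : ℝ≥0∞) ≤ (((2 * r : ℕ) : ℕ∞) : ℝ≥0∞) := ENat.toENNReal_le.2 h4
    _ = ENNReal.ofReal ((2 * r : ℕ) : ℝ) := by
      rw [ENat.toENNReal_coe, ENNReal.ofReal_natCast]
    _ ≤ _ := ENNReal.ofReal_le_ofReal (by push_cast; linarith)

lemma sum_card_le_of_isTree [Fintype V] {H : SimpleGraph V} {σ : V → Finset V}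
    (hσ : Valid H σ) (hT : (created σ).IsTree) :
    ∑ v, (σ v).card ≤ 2 * (Fintype.card V - 1) := by
  have h1 : ∀ v, (σ v).card ≤ (created σ).degree v := fun v => by
    rw [← SimpleGraph.card_neighborFinset_eq_degree]
    refine Finset.card_le_card fun w hw => ?_
    rw [SimpleGraph.mem_neighborFinset, created_adj]
    exact ⟨(hσ v w hw).ne, Or.inl hw⟩
  have h2 := (created σ).sum_degrees_eq_twice_card_edges
  have h3 := hT.card_edgeFinset
  have h4 := Finset.sum_le_sum fun v (_ : v ∈ Finset.univ) => h1 v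
  omega

lemma card_le_sum_card_add_one [Fintype V] {τ : V → Finset V} (hτ : (created τ).Connected) :
    Fintype.card V ≤ ∑ v, (τ v).card + 1 := by
  have h1 := hτ.card_vert_le_card_edgeSet_add_one
  have h2 : (created τ).edgeFinset ⊆
      Finset.univ.biUnion fun v => (τ v).image fun w => s(v, w) := by
    intro e
    induction e with
    | _ u v =>
      intro h
      rw [SimpleGraph.mem_edgeFinset, SimpleGraph.mem_edgeSet, created_adj] at h
      simp only [Finset.mem_biUnion, Finset.mem_univ, true_and, Finset.mem_image]
      rcases h.2 with h | h
      · exact ⟨u, v, h, rfl⟩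
      · exact ⟨v, u, h, Sym2.eq_swap⟩
  have h3 := (Finset.card_le_card h2).trans
    (Finset.card_biUnion_le.trans (Finset.sum_le_sum fun v _ => Finset.card_image_le))
  rw [Nat.card_eq_fintype_card, Nat.card_eq_fintype_card, ← SimpleGraph.edgeFinset_card] at h1
  omega

lemma radius_le_ecc {G H : SimpleGraph V} (h : G ≤ H) (v : V) : radius H ≤ ecc G v :=
  (iInf_le _ v).trans (iSup_mono fun _ => SimpleGraph.edist_anti h)

end NCG

/-- There is a universal constant `C > 0` such that every tree
Nash equilibrium has social cost within a factor `C·(1 + min{α, ρ_H})` of the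
social cost of any connected strategy profile; i.e., tree equilibria are
within `min{O(1 + α), O(ρ_H)}` of the optimum. -/
theorem tree_equilibrium_social_cost :
    ∃ C : ℝ, 0 < C ∧
      ∀ (V : Type) [Fintype V] [DecidableEq V]
        (H : SimpleGraph V), H.Connected → 2 ≤ Fintype.card V →
        ∀ α : ℝ, 0 ≤ α →
        ∀ σ : V → Finset V, NCG.IsNE H α σ → (NCG.created σ).IsTree →
        ∀ τ : V → Finset V, NCG.Valid H τ → (NCG.created τ).Connected →
        NCG.SC α σ ≤
          ENNReal.ofReal C * (1 + min (ENNReal.ofReal α) (NCG.radius H : ℝ≥0∞)) *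
            NCG.SC α τ := by
  refine ⟨16, by norm_num, ?_⟩
  intro V _ _ H hH hn α hα σ hσ hT τ hτ hτc
  obtain ⟨ρ, hρ, hρd⟩ := NCG.exists_radius_eq hH
  set n := Fintype.card V with hndef
  have hub : NCG.SC α σ ≤
      ENNReal.ofReal (α * (2 * n) + n * (4 * (α + 2) * ρ)) := by
    have hs : ∑ v, (σ v).card ≤ 2 * n := by
      have := NCG.sum_card_le_of_isTree hσ.1 hT
      omega
    calc NCG.SC α σ
        = ENNReal.ofReal α * (∑ v, (σ v).card : ℕ) +
            ∑ v, (NCG.ecc (NCG.created σ) v : ℝ≥0∞) := by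
          simp only [NCG.SC, NCG.cost, Finset.sum_add_distrib, Nat.cast_sum, Finset.mul_sum]
      _ ≤ ENNReal.ofReal α * (2 * n : ℕ) +
            ∑ _v : V, ENNReal.ofReal (4 * (α + 2) * ρ) := by
          gcongr with v
          exact hσ.ecc_le_of_isTree hα hT hH hρd v
      _ = _ := by
          rw [Finset.sum_const, Finset.card_univ, ← hndef, nsmul_eq_mul,
            ENNReal.ofReal_add (by positivity) (by positivity), ENNReal.ofReal_mul hα,
            ENNReal.ofReal_mul (Nat.cast_nonneg n), ENNReal.ofReal_natCast,
            ← ENNReal.ofReal_natCast (2 * n)]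
          push_cast
          rfl
  have hlb : ENNReal.ofReal (α * (n / 2) + n * ρ) ≤ NCG.SC α τ := by
    have hs : (n / 2 : ℝ) ≤ (∑ v, (τ v).card : ℕ) := by
      have h1 := NCG.card_le_sum_card_add_one hτc
      have h2 : (n : ℝ) ≤ 2 * (∑ v, (τ v).card : ℕ) := by exact_mod_cast (by omega)
      linarith
    calc ENNReal.ofReal (α * (n / 2) + n * ρ)
        ≤ ENNReal.ofReal (α * (∑ v, (τ v).card : ℕ) + n * ρ) :=
          ENNReal.ofReal_le_ofReal (by gcongr)
      _ = ENNReal.ofReal α * (∑ v, (τ v).card : ℕ) + ∑ _v : V, (NCG.radius H : ℝ≥0∞) := by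
          rw [Finset.sum_const, Finset.card_univ, ← hndef, nsmul_eq_mul, hρ, ENat.toENNReal_coe,
            ENNReal.ofReal_add (by positivity) (by positivity), ENNReal.ofReal_mul hα,
            ENNReal.ofReal_mul (Nat.cast_nonneg n), ENNReal.ofReal_natCast,
            ENNReal.ofReal_natCast, ENNReal.ofReal_natCast]
      _ ≤ ENNReal.ofReal α * (∑ v, (τ v).card : ℕ) +
            ∑ v, (NCG.ecc (NCG.created τ) v : ℝ≥0∞) := by
          gcongr with v
          exact NCG.radius_le_ecc hτ.created_le v
      _ = _ := by
          simp only [NCG.SC, NCG.cost, Finset.sum_add_distrib, Nat.cast_sum, Finset.mul_sum]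
  have hmin : 1 + min (ENNReal.ofReal α) (NCG.radius H : ℝ≥0∞) =
      ENNReal.ofReal (1 + min α ρ) := by
    rw [ENNReal.ofReal_add zero_le_one (by positivity), ENNReal.ofReal_one, hρ,
      ENat.toENNReal_coe, ← ENNReal.ofReal_natCast, ENNReal.ofReal_min]
  have hreal : α * (2 * n) + n * (4 * (α + 2) * ρ) ≤
      16 * (1 + min α ρ) * (α * (n / 2) + n * ρ) := by
    have hm : α * ρ ≤ min α ρ * (α + ρ) := by
      have hρ0 : (0 : ℝ) ≤ ρ := by positivity
      rcases min_cases α (ρ : ℝ) with ⟨h, -⟩ | ⟨h, -⟩ <;> rw [h] <;> nlinarith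
    have hm0 : 0 ≤ min α (ρ : ℝ) * ρ := by positivity
    have hkey : 2 * α + 4 * (α + 2) * ρ ≤ 16 * (1 + min α ρ) * (α / 2 + ρ) := by
      nlinarith [Nat.cast_nonneg (α := ℝ) ρ]
    calc α * (2 * n) + n * (4 * (α + 2) * ρ) = n * (2 * α + 4 * (α + 2) * ρ) := by ring
      _ ≤ n * (16 * (1 + min α ρ) * (α / 2 + ρ)) := by gcongr
      _ = _ := by ring
  calc NCG.SC α σ ≤ _ := hub
    _ ≤ ENNReal.ofReal (16 * (1 + min α ρ) * (α * (n / 2) + n * ρ)) :=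
      ENNReal.ofReal_le_ofReal hreal
    _ = ENNReal.ofReal 16 * ENNReal.ofReal (1 + min α ρ) *
        ENNReal.ofReal (α * (n / 2) + n * ρ) := by
      rw [ENNReal.ofReal_mul (by positivity), ENNReal.ofReal_mul (by norm_num)]
    _ ≤ _ := by
      rw [hmin]
      gcongr
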